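/- Local block encoding for the ring with product vacuum: Let N ≥ 3 and let G = (V,E) be the cycle graph with vertices 1, …, N and edges (k, k+1) for k = 1, …, N−1 together with (1, N). Assign local Hilbert spaces H_1 = ℂ² ⊗ ℂ² (two qubits at vertex 1, labelled 1 and 1̄) and H_k = ℂ² for k = 2, …, N, so H = (ℂ²)^{⊗(N+1)}. Define B̂_k = Z_k for k = 1, …, N, Â_{k,k+1} = X_k Y_{k+1} for k = 1, …, N−1, and Â_{1,N} = X_N Y_1 Z_{1̄}, and let C ⊆ H be the span of the computational basis states |z_{1̄}, z_1, …, z_N⟩ with z ∈ {0,1}^{N+1} and Σ_i z_i even. Then: (i) each B̂_k is Hermitian, supported on {k}, and the B̂_k pairwise commute; (ii) each Â_{jk} is Hermitian and supported on {j,k}; (iii) Â_{jk} B̂_l = (−1)^{δ_{jl}+δ_{kl}} B̂_l Â_{jk} and Â_{jk} Â_{lm} = (−1)^{δ_{jl}+δ_{kl}+δ_{jm}+δ_{km}} Â_{lm} Â_{jk} for all edges and vertices; (iv) Â_{jk}² = B̂_k² = Id; (v) C has dimension 2^N, is invariant under all B̂_k and Â_{jk}, contains the product state |0⟩^{⊗(N+1)},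 and every ψ ∈ C satisfies Z_{1̄} Z_1 ⋯ Z_N ψ = ψ, so that the loop relation i^N Â_{1,2} Â_{2,3} ⋯ Â_{N−1,N} Â_{N,1} ψ = ψ (with Â_{N,1} = −Â_{1,N}) holds on C. Hence the local fermionic modes on a single ring admit a local block encoding whose code space contains a basis of product states and in which the fermionic vacuum is encoded as a product state. -/

import Mathlib

open scoped Classical

/-- The Pauli matrix `X`. -/
def PauliX : Matrix (Fin 2) (Fin 2) ℂ := !![0, 1; 1, 0]

/-- The Pauli matrix `Y`. -/
def PauliY : Matrix (Fin 2) (Fin 2) ℂ := !![0, -Complex.I; Complex.I, 0]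

/-- The Pauli matrix `Z`. -/
def PauliZ : Matrix (Fin 2) (Fin 2) ℂ := !![1, 0; 0, -1]

/-- The operator on a register of qubits labelled by `ι` acting as the one-qubit
operator `m` on the qubit `k` and as the identity on all other qubits. -/
def localOp {ι : Type*} [Fintype ι] [DecidableEq ι] (k : ι)
    (m : Matrix (Fin 2) (Fin 2) ℂ) :
    Matrix (ι → Fin 2) (ι → Fin 2) ℂ :=
  fun x y => m (x k) (y k) * if ∀ v ≠ k, x v = y v then 1 else 0

/-- An operator on a register of qubits labelled by `ι` is supported on a set
`T` of qubits if it is of the form `m ⊗ Id`. -/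
def SupportedOnQubits {ι : Type*} (T : Set ι)
    (M : Matrix (ι → Fin 2) (ι → Fin 2) ℂ) : Prop :=
  ∃ m : Matrix ((q : T) → Fin 2) ((q : T) → Fin 2) ℂ,
    ∀ x y : ι → Fin 2, M x y =
      if ∀ q ∉ T, x q = y q then m (fun q => x q.1) (fun q => y q.1) else 0

/-- The qubits belonging to the vertices in `S`: vertex `0` (the paper's vertex
`1`) carries the two qubits `some 0` and `none` (the paper's `1` and `1̄`);
every other vertex `k` carries the single qubit `some k`. -/
def qubitsOfVerts (N : ℕ) [NeZero N] (S : Set (Fin N)) : Set (Option (Fin N)) :=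
  {q | q.elim ((0 : Fin N) ∈ S) (fun k => k ∈ S)}

/-- An operator is supported on a set `S` of vertices of the ring if it is
supported on the set of qubits belonging to the vertices in `S`. -/
def SupportedOnVerts (N : ℕ) [NeZero N] (S : Set (Fin N))
    (M : Matrix (Option (Fin N) → Fin 2) (Option (Fin N) → Fin 2) ℂ) : Prop :=
  SupportedOnQubits (qubitsOfVerts N S) M

/-- Adjacency in the ring (cycle) graph on `Fin N`: the edges are precisely the
pairs `(k, k+1)` (cyclically, so including `(N-1, 0)`, the paper's `(N, 1)`). -/
def RingAdj (N : ℕ) [NeZero N] (j k : Fin N) : Prop := k = j + 1 ∨ j = k + 1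

/-- Kronecker delta of two vertices, as a natural number exponent. -/
def kdelta {V : Type*} [DecidableEq V] (a b : V) : ℕ := if a = b then 1 else 0

/-- The product operator acting as `f q` on each qubit `q`. -/
def tensorOp {ι : Type*} [Fintype ι] (f : ι → Matrix (Fin 2) (Fin 2) ℂ) :
    Matrix (ι → Fin 2) (ι → Fin 2) ℂ :=
  fun x y => ∏ q, f q (x q) (y q)

section TensorOp

variable {ι : Type*} [Fintype ι]

theorem tensorOp_mul [DecidableEq ι] (f g : ι → Matrix (Fin 2) (Fin 2) ℂ) :
    tensorOp f * tensorOp g = tensorOp (f * g) := by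
  ext x y
  simp only [tensorOp, Matrix.mul_apply, Pi.mul_apply, Finset.prod_univ_sum,
    Fintype.piFinset_univ, Finset.prod_mul_distrib]

theorem tensorOp_one [DecidableEq ι] :
    tensorOp (1 : ι → Matrix (Fin 2) (Fin 2) ℂ) = 1 := by
  ext x y
  simp only [tensorOp, Pi.one_apply, Matrix.one_apply, Finset.prod_ite_zero, Finset.mem_univ,
    true_implies, Finset.prod_const_one, funext_iff]

theorem tensorOp_smul (c : ι → ℂ) (f : ι → Matrix (Fin 2) (Fin 2) ℂ) :
    tensorOp (fun q => c q • f q) = (∏ q, c q) • tensorOp f := by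
  ext x y
  simp [tensorOp, Finset.prod_mul_distrib]

theorem localOp_eq_tensorOp [DecidableEq ι] (k : ι) (m : Matrix (Fin 2) (Fin 2) ℂ) :
    localOp k m = tensorOp (Pi.mulSingle k m) := by
  ext x y
  rw [localOp, tensorOp, ← Finset.mul_prod_erase _ _ (Finset.mem_univ k), Pi.mulSingle_eq_same]
  congr 1
  rw [Finset.prod_congr rfl (g := fun v => if x v = y v then (1 : ℂ) else 0)]
  · simp [Finset.prod_ite_zero]
  · intro v hv
    rw [Pi.mulSingle_eq_of_ne (Finset.ne_of_mem_erase hv), Matrix.one_apply]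

theorem tensorOp_mul_eq_smul [DecidableEq ι] {f g : ι → Matrix (Fin 2) (Fin 2) ℂ} (c : ι → ℂ)
    (h : ∀ q, f q * g q = c q • (g q * f q)) :
    tensorOp f * tensorOp g = (∏ q, c q) • (tensorOp g * tensorOp f) := by
  rw [tensorOp_mul, tensorOp_mul, ← tensorOp_smul]
  exact congrArg tensorOp (funext h)

theorem tensorOp_isHermitian {f : ι → Matrix (Fin 2) (Fin 2) ℂ} (h : ∀ q, (f q).IsHermitian) :
    (tensorOp f).IsHermitian := by
  ext x y
  simp only [tensorOp, Matrix.conjTranspose_apply, star_prod]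
  exact Finset.prod_congr rfl fun q _ => (h q).apply _ _

theorem tensorOp_sq [DecidableEq ι] {f : ι → Matrix (Fin 2) (Fin 2) ℂ}
    (h : ∀ q, f q * f q = 1) : tensorOp f ^ 2 = 1 := by
  rw [sq, tensorOp_mul, ← tensorOp_one]
  exact congrArg tensorOp (funext h)

theorem supportedOnQubits_tensorOp {T : Set ι} {f : ι → Matrix (Fin 2) (Fin 2) ℂ}
    (h : ∀ q ∉ T, f q = 1) : SupportedOnQubits T (tensorOp f) := by
  classical
  refine ⟨tensorOp fun q : T => f q, fun x y => ?_⟩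
  have hT : ∏ q : {q // q ∉ T}, f q (x q) (y q) = if ∀ q ∉ T, x q = y q then 1 else 0 := by
    rw [Fintype.prod_congr _ (fun q : {q // q ∉ T} => if x q = y q then (1 : ℂ) else 0)
      fun q => by rw [h q q.2, Matrix.one_apply]]
    simp [Finset.prod_ite_zero]
  rw [tensorOp, ← Fintype.prod_subtype_mul_prod_subtype (· ∈ T), hT, mul_ite, mul_one, mul_zero]
  congr

theorem SupportedOnQubits.neg {T : Set ι} {M : Matrix (ι → Fin 2) (ι → Fin 2) ℂ}
    (h : SupportedOnQubits T M) : SupportedOnQubits T (-M) := by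
  obtain ⟨m, hm⟩ := h
  refine ⟨-m, fun x y => ?_⟩
  rw [Matrix.neg_apply, hm]
  split_ifs <;> simp

end TensorOp

section Pauli

theorem pauliX_mul_self : PauliX * PauliX = 1 := by
  simp [PauliX, Matrix.one_fin_two]

theorem pauliY_mul_self : PauliY * PauliY = 1 := by
  simp [PauliY, Matrix.one_fin_two]

theorem pauliZ_mul_self : PauliZ * PauliZ = 1 := by
  simp [PauliZ, Matrix.one_fin_two]

theorem pauliX_mul_pauliZ : PauliX * PauliZ = -(PauliZ * PauliX) := by
  simp [PauliX, PauliZ]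

theorem pauliY_mul_pauliZ : PauliY * PauliZ = -(PauliZ * PauliY) := by
  simp [PauliY, PauliZ]

theorem pauliX_mul_pauliY : PauliX * PauliY = Complex.I • PauliZ := by
  simp [PauliX, PauliY, PauliZ]

theorem pauliY_mul_pauliX : PauliY * PauliX = (-Complex.I) • PauliZ := by
  simp [PauliX, PauliY, PauliZ]

theorem pauliX_isHermitian : PauliX.IsHermitian := by
  ext i j; fin_cases i <;> fin_cases j <;> simp [PauliX]

theorem pauliY_isHermitian : PauliY.IsHermitian := by
  ext i j; fin_cases i <;> fin_cases j <;> simp [PauliY]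

theorem pauliZ_isHermitian : PauliZ.IsHermitian := by
  ext i j; fin_cases i <;> fin_cases j <;> simp [PauliZ]

theorem pauliZ_eq_diagonal : PauliZ = Matrix.diagonal fun i : Fin 2 => (-1) ^ (i : ℕ) := by
  ext i j; fin_cases i <;> fin_cases j <;> simp [PauliZ]

end Pauli

section Parity

variable (ι : Type*) [Fintype ι]

/-- The product of the operators `Z` on all qubits. -/
def parityOp : Matrix (ι → Fin 2) (ι → Fin 2) ℂ :=
  tensorOp fun _ => PauliZ

/-- The span of the computational basis states of even weight. -/
def evenSpace [DecidableEq ι] : Submodule ℂ ((ι → Fin 2) → ℂ) :=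
  Submodule.span ℂ {ψ | ∃ z : ι → Fin 2, (∑ q, (z q : ℕ)) % 2 = 0 ∧ ψ = Pi.single z 1}

variable {ι}

theorem parityOp_eq_diagonal :
    parityOp ι = Matrix.diagonal fun z => (-1) ^ (∑ q, (z q : ℕ)) := by
  ext x y
  simp only [parityOp, tensorOp, pauliZ_eq_diagonal, Matrix.diagonal_apply, Finset.prod_ite_zero,
    Finset.mem_univ, true_implies, Finset.prod_pow_eq_pow_sum, funext_iff]

variable [DecidableEq ι]

theorem mem_evenSpace_iff {ψ : (ι → Fin 2) → ℂ} :
    ψ ∈ evenSpace ι ↔ (parityOp ι).mulVec ψ = ψ := by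
  rw [parityOp_eq_diagonal]
  constructor
  · intro h
    induction h using Submodule.span_induction with
    | mem ψ h =>
      obtain ⟨z, hz, rfl⟩ := h
      rw [Matrix.diagonal_mulVec_single, (Nat.even_iff.mpr hz).neg_one_pow, one_mul]
    | zero => exact Matrix.mulVec_zero _
    | add a b _ _ ha hb => rw [Matrix.mulVec_add, ha, hb]
    | smul c a _ ha => rw [Matrix.mulVec_smul, ha]
  · intro h
    rw [← Finset.univ_sum_single ψ]
    refine Submodule.sum_mem _ fun z _ => ?_
    rcases Nat.even_or_odd (∑ q, (z q : ℕ)) with hz | hz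
    · have := Submodule.smul_mem (evenSpace ι) (ψ z)
        (Submodule.subset_span ⟨z, Nat.even_iff.mp hz, rfl⟩)
      rwa [← Pi.single_smul', smul_eq_mul, mul_one] at this
    · have hψ := congrFun h z
      rw [Matrix.mulVec_diagonal, hz.neg_one_pow, neg_one_mul, neg_eq_self] at hψ
      rw [hψ, Pi.single_zero]
      exact Submodule.zero_mem _

theorem mulVec_mem_evenSpace {M : Matrix (ι → Fin 2) (ι → Fin 2) ℂ}
    (h : Commute M (parityOp ι)) {ψ : (ι → Fin 2) → ℂ} (hψ : ψ ∈ evenSpace ι) :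
    M.mulVec ψ ∈ evenSpace ι := by
  rw [mem_evenSpace_iff] at hψ ⊢
  rw [Matrix.mulVec_mulVec, ← h.eq, ← Matrix.mulVec_mulVec, hψ]

theorem card_even_weight_option (κ : Type*) [Fintype κ] [DecidableEq κ] :
    Fintype.card {z : Option κ → Fin 2 // (∑ q, (z q : ℕ)) % 2 = 0} = 2 ^ Fintype.card κ := by
  rw [← Fintype.card_fin 2, ← Fintype.card_fun, Fintype.card_fin]
  refine Fintype.card_of_bijective (f := fun z k => z.1 (some k)) ⟨fun z w h => ?_, fun z => ?_⟩
  · have hs : ∀ k, z.1 (some k) = w.1 (some k) := congrFun h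
    have hz := z.2
    have hw := w.2
    simp only [Fintype.sum_option, hs] at hz hw
    refine Subtype.ext (funext fun q => ?_)
    cases q with
    | none => exact Fin.ext (by omega)
    | some k => exact hs k
  · refine ⟨⟨fun q => q.elim (Fin.ofNat 2 (∑ k, (z k : ℕ))) z, ?_⟩, rfl⟩
    simp only [Fintype.sum_option, Option.elim, Fin.val_ofNat]
    omega

theorem finrank_evenSpace_option (κ : Type*) [Fintype κ] [DecidableEq κ] :
    Module.finrank ℂ (evenSpace (Option κ)) = 2 ^ Fintype.card κ := by
  rw [← card_even_weight_option]
  have hli := (Pi.linearIndependent_single_one (Option κ → Fin 2) ℂ).comp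
    (Subtype.val : {z : Option κ → Fin 2 // (∑ q, (z q : ℕ)) % 2 = 0} → _)
    Subtype.val_injective
  have hset : {ψ : (Option κ → Fin 2) → ℂ | ∃ z : Option κ → Fin 2,
      (∑ q, (z q : ℕ)) % 2 = 0 ∧ ψ = Pi.single z 1} =
      Set.range ((fun z => Pi.single z 1) ∘
        (Subtype.val : {z : Option κ → Fin 2 // (∑ q, (z q : ℕ)) % 2 = 0} → _)) :=
    Set.ext fun ψ => ⟨fun ⟨z, hz, h⟩ => ⟨⟨z, hz⟩, h.symm⟩, fun ⟨z, h⟩ => ⟨z, z.2, h.symm⟩⟩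
  rw [← finrank_span_eq_card hli, evenSpace, hset]

end Parity

section Ring

variable {N : ℕ} [NeZero N]

/-- The one-qubit factors of the edge operator `Â_{t,t+1}`; on the extra qubit it is `-Z` for the
edge closing the ring. -/
def edgeFactor (t : Fin N) : Option (Fin N) → Matrix (Fin 2) (Fin 2) ℂ
  | none => if t + 1 = 0 then -PauliZ else 1
  | some k => if k = t then PauliX else if k = t + 1 then PauliY else 1

/-- The edge operator `Â_{t,t+1}`. -/
def edgeOp (t : Fin N) : Matrix (Option (Fin N) → Fin 2) (Option (Fin N) → Fin 2) ℂ :=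
  tensorOp (edgeFactor t)

/-- The antisymmetric family of edge operators `Â_{jk}`. -/
def ringOp (j k : Fin N) : Matrix (Option (Fin N) → Fin 2) (Option (Fin N) → Fin 2) ℂ :=
  if k = j + 1 then edgeOp j else -edgeOp k

theorem add_one_ne_self (hN : 3 ≤ N) (t : Fin N) : t + 1 ≠ t := by
  have : N ≠ 1 := by omega
  simpa

theorem add_one_add_one_ne_self (hN : 3 ≤ N) (t : Fin N) : t + 1 + 1 ≠ t := by
  obtain ⟨M, rfl⟩ : ∃ M, N = M + 3 := ⟨N - 3, by omega⟩
  rw [add_assoc, Ne, add_eq_left, Fin.ext_iff]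
  simp [Fin.val_add, Nat.mod_eq_of_lt (show 2 < M + 3 by omega)]

theorem ringOp_succ (t : Fin N) : ringOp t (t + 1) = edgeOp t := if_pos rfl

theorem ringOp_pred (hN : 3 ≤ N) (t : Fin N) : ringOp (t + 1) t = -edgeOp t :=
  if_neg (add_one_add_one_ne_self hN t).symm

theorem edgeOp_of_ne (hN : 3 ≤ N) {t : Fin N} (ht : t + 1 ≠ 0) :
    edgeOp t = localOp (some t) PauliX * localOp (some (t + 1)) PauliY := by
  rw [localOp_eq_tensorOp, localOp_eq_tensorOp, tensorOp_mul, edgeOp]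
  congr 1
  have := add_one_ne_self hN t
  funext q
  cases q with
  | none => simp [edgeFactor, ht]
  | some k =>
    simp only [edgeFactor, Pi.mul_apply, Pi.mulSingle_apply, Option.some.injEq]
    split_ifs <;> simp_all

theorem neg_edgeOp_of_eq (hN : 3 ≤ N) {t : Fin N} (ht : t + 1 = 0) :
    -edgeOp t = localOp (some t) PauliX * localOp (some (0 : Fin N)) PauliY *
      localOp none PauliZ := by
  have hneg : -edgeOp t =
      tensorOp (fun q => (if q = none then (-1 : ℂ) else 1) • edgeFactor t q) := by
    rw [tensorOp_smul, Finset.prod_ite_eq' Finset.univ none, if_pos (Finset.mem_univ _),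
      neg_one_smul, edgeOp]
  rw [hneg, localOp_eq_tensorOp, localOp_eq_tensorOp, localOp_eq_tensorOp, tensorOp_mul,
    tensorOp_mul]
  congr 1
  have := add_one_ne_self hN t
  funext q
  cases q with
  | none => simp [edgeFactor, ht]
  | some k =>
    simp only [edgeFactor, Pi.mul_apply, Pi.mulSingle_apply, Option.some.injEq, ht, reduceCtorEq,
      if_false]
    split_ifs <;> simp_all

theorem edgeFactor_isHermitian (t : Fin N) (q : Option (Fin N)) :
    (edgeFactor t q).IsHermitian := by
  cases q <;> simp only [edgeFactor] <;> split_ifs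
  exacts [pauliZ_isHermitian.neg, Matrix.isHermitian_one, pauliX_isHermitian, pauliY_isHermitian,
    Matrix.isHermitian_one]

theorem edgeFactor_mul_self (t : Fin N) (q : Option (Fin N)) :
    edgeFactor t q * edgeFactor t q = 1 := by
  cases q <;> simp only [edgeFactor] <;> split_ifs <;>
    simp [pauliX_mul_self, pauliY_mul_self, pauliZ_mul_self]

theorem edgeOp_supported (t : Fin N) : SupportedOnVerts N {t, t + 1} (edgeOp t) := by
  refine supportedOnQubits_tensorOp fun q hq => ?_
  cases q <;> simp_all [qubitsOfVerts, edgeFactor, eq_comm]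

theorem edgeOp_mul_pauliZ (hN : 3 ≤ N) (t l : Fin N) :
    edgeOp t * localOp (some l) PauliZ =
      ((-1 : ℂ) ^ (kdelta t l + kdelta (t + 1) l)) • (localOp (some l) PauliZ * edgeOp t) := by
  have hc : ∏ q : Option (Fin N),
      (if q = some l then (-1 : ℂ) ^ (kdelta t l + kdelta (t + 1) l) else 1) =
        (-1 : ℂ) ^ (kdelta t l + kdelta (t + 1) l) := by
    rw [Finset.prod_ite_eq' Finset.univ (some l), if_pos (Finset.mem_univ _)]
  rw [localOp_eq_tensorOp, edgeOp, tensorOp_mul_eq_smul _ fun q => ?_, hc]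
  have := add_one_ne_self hN t
  rcases eq_or_ne q (some l) with rfl | hq
  · simp only [edgeFactor, Pi.mulSingle_eq_same, if_true, kdelta, eq_comm (b := l)]
    rcases eq_or_ne l t with rfl | h
    · simp [this.symm, pauliX_mul_pauliZ]
    · rcases eq_or_ne l (t + 1) with rfl | h'
      · simp [h, pauliY_mul_pauliZ]
      · simp [h, h']
  · simp [hq]

theorem edgeOp_mul_edgeOp (hN : 3 ≤ N) (t s : Fin N) :
    edgeOp t * edgeOp s =
      ((-1 : ℂ) ^ (kdelta t (s + 1) + kdelta (t + 1) s)) • (edgeOp s * edgeOp t) := by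
  have hc : ∏ q : Option (Fin N),
      (if q = some t then (-1 : ℂ) ^ kdelta t (s + 1) else 1) *
        (if q = some (t + 1) then (-1 : ℂ) ^ kdelta (t + 1) s else 1) =
        (-1 : ℂ) ^ (kdelta t (s + 1) + kdelta (t + 1) s) := by
    rw [Finset.prod_mul_distrib, Finset.prod_ite_eq' Finset.univ (some t),
      Finset.prod_ite_eq' Finset.univ (some (t + 1)), if_pos (Finset.mem_univ _),
      if_pos (Finset.mem_univ _), pow_add]
  rw [edgeOp, edgeOp, tensorOp_mul_eq_smul _ fun q => ?_, hc]
  have ht := add_one_ne_self hN t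
  have hs := add_one_ne_self hN s
  cases q with
  | none => simp only [edgeFactor]; split_ifs <;> simp_all
  | some k =>
    simp only [edgeFactor, Option.some.injEq, kdelta]
    split_ifs <;> simp_all [pauliX_mul_pauliY, pauliY_mul_pauliX]

theorem edgeOp_commute_parityOp (hN : 3 ≤ N) (t : Fin N) :
    Commute (edgeOp t) (parityOp (Option (Fin N))) := by
  have hc : ∏ q : Option (Fin N),
      (if q = some t then (-1 : ℂ) else 1) * (if q = some (t + 1) then (-1 : ℂ) else 1) = 1 := by
    rw [Finset.prod_mul_distrib, Finset.prod_ite_eq' Finset.univ (some t),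
      Finset.prod_ite_eq' Finset.univ (some (t + 1)), if_pos (Finset.mem_univ _),
      if_pos (Finset.mem_univ _), neg_one_mul, neg_neg]
  rw [commute_iff_eq, edgeOp, parityOp, tensorOp_mul_eq_smul _ fun q => ?_, hc, one_smul]
  have ht := add_one_ne_self hN t
  cases q with
  | none => simp only [edgeFactor]; split_ifs <;> simp_all
  | some k =>
    simp only [edgeFactor, Option.some.injEq]
    split_ifs <;> simp_all [pauliX_mul_pauliZ, pauliY_mul_pauliZ]

theorem localOp_pauliZ_commute_parityOp {ι : Type*} [Fintype ι] [DecidableEq ι] (q : ι) :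
    Commute (localOp q PauliZ) (parityOp ι) := by
  rw [commute_iff_eq, localOp_eq_tensorOp, parityOp, tensorOp_mul, tensorOp_mul]
  congr 1
  funext r
  simp only [Pi.mul_apply, Pi.mulSingle_apply]
  split_ifs <;> simp

end Ring

section Products

variable {ι : Type*} [Fintype ι] [DecidableEq ι]

/-- `tensorOp` as a homomorphism of monoids. -/
def tensorHom (ι : Type*) [Fintype ι] [DecidableEq ι] :
    (ι → Matrix (Fin 2) (Fin 2) ℂ) →* Matrix (ι → Fin 2) (ι → Fin 2) ℂ where
  toFun := tensorOp
  map_one' := tensorOp_one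
  map_mul' f g := (tensorOp_mul f g).symm

theorem tensorOp_list_prod {n : ℕ} (f : Fin n → ι → Matrix (Fin 2) (Fin 2) ℂ) :
    (List.ofFn fun t => tensorOp (f t)).prod = tensorOp (List.ofFn f).prod := by
  change _ = tensorHom ι _
  rw [map_list_prod, List.map_ofFn]
  rfl

theorem localOp_pauliZ_mul_prod (N : ℕ) :
    localOp (none : Option (Fin N)) PauliZ *
      (List.ofFn fun k : Fin N => localOp (some k) PauliZ).prod = parityOp (Option (Fin N)) := by
  simp only [localOp_eq_tensorOp, tensorOp_list_prod, tensorOp_mul, parityOp]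
  congr 1
  suffices h : ∀ n (hn : n ≤ N), (List.ofFn fun k : Fin n =>
      (Pi.mulSingle (some (k.castLE hn)) PauliZ : Option (Fin N) → _)).prod =
      fun q => q.elim 1 fun k => if k.1 < n then PauliZ else 1 by
    have := h N le_rfl
    simp only [Fin.castLE_rfl, id] at this
    rw [this]
    funext q
    cases q <;> simp
  intro n
  induction n with
  | zero => intro _; funext q; cases q <;> simp
  | succ n ih =>
    intro hn
    have := ih (by omega)
    rw [List.ofFn_succ_last, List.prod_append, List.prod_singleton]
    simp only [Fin.castLE_castSucc]
    rw [this]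
    funext q
    cases q with
    | none => simp
    | some k =>
      rcases lt_trichotomy k.1 n with h | h | h
      · have : k ≠ Fin.castLE hn (Fin.last n) := by simp [Fin.ext_iff]; omega
        simp [h, this]; omega
      · have : k = Fin.castLE hn (Fin.last n) := by simp [Fin.ext_iff]; omega
        simp [this]
      · have : k ≠ Fin.castLE hn (Fin.last n) := by simp [Fin.ext_iff]; omega
        simp [this, show ¬ k.1 < n by omega]; omega

end Products

section Loop

variable {N : ℕ} [NeZero N]

/-- The one-qubit factors of the product of the first `n` edge operators. -/
def pathFactor (N n : ℕ) [NeZero N] : Option (Fin N) → Matrix (Fin 2) (Fin 2) ℂ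
  | none => 1
  | some k => if k = 0 then (if n = 0 then 1 else PauliX) else
      if k.1 < n then (-Complex.I) • PauliZ else if k.1 = n then (if n = 0 then 1 else PauliY) else 1

theorem prod_edgeFactor (hN : 3 ≤ N) : ∀ n (hn : n < N),
    (List.ofFn fun t : Fin n => edgeFactor (t.castLE hn.le)).prod = pathFactor N n
  | 0, _ => by
    funext q
    cases q with
    | none => simp [pathFactor]
    | some k =>
      simp only [List.ofFn_zero, List.prod_nil, Pi.one_apply, pathFactor]
      split_ifs <;> simp_all
  | n + 1, hn => by
    have ih := prod_edgeFactor hN n (by omega)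
    rw [List.ofFn_succ_last, List.prod_append, List.prod_singleton]
    simp only [Fin.castLE_castSucc]
    rw [ih]
    have h1 : (Fin.castLE hn.le (Fin.last n) : Fin N).1 = n := rfl
    have h2 : (Fin.castLE hn.le (Fin.last n) + 1 : Fin N).1 = n + 1 := by
      rw [Fin.val_add_one_of_lt', h1]
      rw [h1]; exact hn
    funext q
    cases q with
    | none => simp [pathFactor, edgeFactor, Fin.ext_iff, h2]
    | some k =>
      simp only [pathFactor, edgeFactor, Pi.mul_apply, Fin.ext_iff, h1, h2, Fin.val_zero]
      split_ifs <;> first | omega | simp_all [pauliY_mul_pauliX]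

theorem prod_edgeOp (hN : 3 ≤ N) :
    (List.ofFn fun t : Fin N => edgeOp t).prod =
      (-Complex.I) ^ N • parityOp (Option (Fin N)) := by
  have hc : ∏ q : Option (Fin N), q.elim (-1 : ℂ) (fun k => if k = 0 then Complex.I else -Complex.I)
      = (-Complex.I) ^ N := by
    have h (k : Fin N) : (if k = 0 then Complex.I else -Complex.I) =
        (if k = 0 then -1 else 1) * -Complex.I := by split_ifs <;> simp
    rw [Fintype.prod_option]
    simp only [Option.elim, h, Finset.prod_mul_distrib, Finset.prod_ite_eq', Finset.mem_univ,
      if_true, Finset.prod_const, Finset.card_univ, Fintype.card_fin]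
    ring
  rw [← hc, parityOp, ← tensorOp_smul]
  simp only [edgeOp, tensorOp_list_prod]
  congr 1
  obtain ⟨M, rfl⟩ : ∃ M, N = M + 1 := ⟨N - 1, by omega⟩
  have hp := prod_edgeFactor hN M (by omega)
  rw [List.ofFn_succ_last, List.prod_append, List.prod_singleton]
  have hp' : (List.ofFn fun t : Fin M => edgeFactor t.castSucc).prod = pathFactor (M + 1) M := hp
  rw [hp']
  have hl : Fin.last M + 1 = 0 := by simp
  funext q
  cases q with
  | none => simp [pathFactor, edgeFactor]
  | some k =>
    simp only [pathFactor, edgeFactor, Pi.mul_apply, hl, Fin.ext_iff, Fin.val_zero, Fin.val_last,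
      Option.elim]
    split_ifs <;> first | omega | simp_all [pauliX_mul_pauliY, pauliY_mul_pauliX]

end Loop

section RingOp

variable {N : ℕ} [NeZero N]

theorem RingAdj.exists_edge (hN : 3 ≤ N) {j k : Fin N} (h : RingAdj N j k) :
    ∃ t, (j = t ∧ k = t + 1 ∧ ringOp j k = edgeOp t) ∨
      (j = t + 1 ∧ k = t ∧ ringOp j k = -edgeOp t) := by
  rcases h with rfl | rfl
  exacts [⟨j, .inl ⟨rfl, rfl, ringOp_succ j⟩⟩, ⟨k, .inr ⟨rfl, rfl, ringOp_pred hN k⟩⟩]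

theorem ringOp_swap (hN : 3 ≤ N) {j k : Fin N} (h : RingAdj N j k) :
    ringOp k j = -ringOp j k := by
  rcases h with rfl | rfl <;> simp [ringOp_succ, ringOp_pred hN]

theorem ringOp_mul_ringOp (hN : 3 ≤ N) {j k l m : Fin N} (h : RingAdj N j k)
    (h' : RingAdj N l m) :
    ringOp j k * ringOp l m =
      ((-1 : ℂ) ^ (kdelta j l + kdelta k l + kdelta j m + kdelta k m)) •
        (ringOp l m * ringOp j k) := by
  have hsign (t s : Fin N) : (-1 : ℂ) ^ (kdelta t s + kdelta (t + 1) s + kdelta t (s + 1) +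
      kdelta (t + 1) (s + 1)) = (-1) ^ (kdelta t (s + 1) + kdelta (t + 1) s) := by
    have : kdelta (t + 1) (s + 1) = kdelta t s := by simp [kdelta]
    rw [this, show kdelta t s + kdelta (t + 1) s + kdelta t (s + 1) + kdelta t s =
      2 * kdelta t s + (kdelta t (s + 1) + kdelta (t + 1) s) by ring, pow_add, pow_mul]
    simp
  obtain ⟨t, ⟨rfl, rfl, e⟩ | ⟨rfl, rfl, e⟩⟩ := h.exists_edge hN <;>
  obtain ⟨s, ⟨rfl, rfl, e'⟩ | ⟨rfl, rfl, e'⟩⟩ := h'.exists_edge hN <;>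
  rw [e, e'] <;>
  (try simp only [neg_mul, mul_neg, neg_neg, smul_neg, neg_inj]) <;>
  rw [edgeOp_mul_edgeOp hN, ← hsign] <;>
  congr 2 <;>
  ring

theorem ringOp_mul_pauliZ (hN : 3 ≤ N) {j k : Fin N} (l : Fin N) (h : RingAdj N j k) :
    ringOp j k * localOp (some l) PauliZ =
      ((-1 : ℂ) ^ (kdelta j l + kdelta k l)) • (localOp (some l) PauliZ * ringOp j k) := by
  obtain ⟨t, ⟨rfl, rfl, e⟩ | ⟨rfl, rfl, e⟩⟩ := h.exists_edge hN <;> rw [e]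
  · exact edgeOp_mul_pauliZ hN _ l
  · rw [neg_mul, mul_neg, smul_neg, edgeOp_mul_pauliZ hN, add_comm]

theorem ringOp_isHermitian (hN : 3 ≤ N) {j k : Fin N} (h : RingAdj N j k) :
    (ringOp j k).IsHermitian := by
  obtain ⟨t, ⟨-, -, e⟩ | ⟨-, -, e⟩⟩ := h.exists_edge hN <;> rw [e]
  exacts [tensorOp_isHermitian (edgeFactor_isHermitian t),
    (tensorOp_isHermitian (edgeFactor_isHermitian t)).neg]

theorem ringOp_supported (hN : 3 ≤ N) {j k : Fin N} (h : RingAdj N j k) :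
    SupportedOnVerts N {j, k} (ringOp j k) := by
  obtain ⟨t, ⟨rfl, rfl, e⟩ | ⟨rfl, rfl, e⟩⟩ := h.exists_edge hN <;> rw [e]
  · exact edgeOp_supported _
  · rw [Set.pair_comm]
    exact (edgeOp_supported _).neg

theorem ringOp_sq (hN : 3 ≤ N) {j k : Fin N} (h : RingAdj N j k) : ringOp j k ^ 2 = 1 := by
  obtain ⟨t, ⟨-, -, e⟩ | ⟨-, -, e⟩⟩ := h.exists_edge hN <;> rw [e]
  · exact tensorOp_sq (edgeFactor_mul_self t)
  · rw [neg_sq]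
    exact tensorOp_sq (edgeFactor_mul_self t)

theorem ringOp_commute_parityOp (hN : 3 ≤ N) {j k : Fin N} (h : RingAdj N j k) :
    Commute (ringOp j k) (parityOp (Option (Fin N))) := by
  obtain ⟨t, ⟨-, -, e⟩ | ⟨-, -, e⟩⟩ := h.exists_edge hN <;> rw [e]
  exacts [edgeOp_commute_parityOp hN t, (edgeOp_commute_parityOp hN t).neg_left]

end RingOp

section LocalOp

variable {ι : Type*} [Fintype ι] [DecidableEq ι]

theorem localOp_isHermitian (q : ι) {m : Matrix (Fin 2) (Fin 2) ℂ} (hm : m.IsHermitian) :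
    (localOp q m).IsHermitian := by
  rw [localOp_eq_tensorOp]
  refine tensorOp_isHermitian fun r => ?_
  rw [Pi.mulSingle_apply]
  split_ifs
  exacts [hm, Matrix.isHermitian_one]

theorem localOp_sq (q : ι) {m : Matrix (Fin 2) (Fin 2) ℂ} (hm : m * m = 1) :
    localOp q m ^ 2 = 1 := by
  rw [localOp_eq_tensorOp, sq, tensorOp_mul, ← Pi.mulSingle_mul, hm, Pi.mulSingle_one,
    tensorOp_one]

theorem localOp_mul_localOp_comm (q r : ι) (m : Matrix (Fin 2) (Fin 2) ℂ) :
    localOp q m * localOp r m = localOp r m * localOp q m := by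
  rcases eq_or_ne q r with rfl | h
  · rfl
  · rw [localOp_eq_tensorOp, localOp_eq_tensorOp, tensorOp_mul, tensorOp_mul,
      (Pi.mulSingle_commute (f := fun _ : ι => Matrix (Fin 2) (Fin 2) ℂ) h m m).eq]

theorem localOp_some_supported {N : ℕ} [NeZero N] (k : Fin N) (m : Matrix (Fin 2) (Fin 2) ℂ) :
    SupportedOnVerts N {k} (localOp (some k) m) := by
  rw [localOp_eq_tensorOp]
  refine supportedOnQubits_tensorOp fun q hq => Pi.mulSingle_eq_of_ne ?_ _
  rintro rfl
  exact hq rfl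

end LocalOp

/-- local block encoding of the ring with product vacuum: for
`N ≥ 3` fermionic modes on a ring, with one qubit per vertex plus an extra
qubit `1̄` at vertex `1`, the operators `B̂_k = Z_k`, `Â_{k,k+1} = X_k Y_{k+1}`,
`Â_{1,N} = X_N Y_1 Z_{1̄}` and the even-parity subspace `C` form a local
fermionic block encoding: the stated hermiticity, support, (anti)commutation
and involution relations hold exactly, `C` has dimension `2^N`, is invariant,
contains the product state `|0⟩^{⊗(N+1)}`, and on `C` the global parity and the
loop relation hold. -/
theorem ring_local_block_encoding (N : ℕ) (hN : 3 ≤ N) [NeZero N] :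
    ∃ (B : Fin N → Matrix (Option (Fin N) → Fin 2) (Option (Fin N) → Fin 2) ℂ)
      (A : Fin N → Fin N →
        Matrix (Option (Fin N) → Fin 2) (Option (Fin N) → Fin 2) ℂ)
      (C : Submodule ℂ ((Option (Fin N) → Fin 2) → ℂ)),
      -- defining equations for B, A and C
      (∀ k, B k = localOp (some k) PauliZ) ∧
      (∀ k : Fin N, (k : ℕ) < N - 1 →
          A k (k + 1) = localOp (some k) PauliX * localOp (some (k + 1)) PauliY) ∧
      (A 0 ⟨N - 1, by omega⟩ =
          localOp (some (⟨N - 1, by omega⟩ : Fin N)) PauliX *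
            localOp (some (0 : Fin N)) PauliY *
            localOp (none : Option (Fin N)) PauliZ) ∧
      (∀ j k, RingAdj N j k → A k j = - A j k) ∧
      (C = Submodule.span ℂ
          {ψ : (Option (Fin N) → Fin 2) → ℂ | ∃ z : Option (Fin N) → Fin 2,
            (∑ q, (z q : ℕ)) % 2 = 0 ∧ ψ = Pi.single z 1}) ∧
      -- (i)
      (∀ k, (B k).IsHermitian ∧ SupportedOnVerts N {k} (B k)) ∧
      (∀ j k, B j * B k = B k * B j) ∧
      -- (ii)
      (∀ j k, RingAdj N j k → (A j k).IsHermitian ∧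
          SupportedOnVerts N {j, k} (A j k)) ∧
      -- (iii)
      (∀ j k l, RingAdj N j k →
          A j k * B l = ((-1 : ℂ) ^ (kdelta j l + kdelta k l)) • (B l * A j k)) ∧
      (∀ j k l m, RingAdj N j k → RingAdj N l m →
          A j k * A l m =
            ((-1 : ℂ) ^ (kdelta j l + kdelta k l + kdelta j m + kdelta k m)) •
              (A l m * A j k)) ∧
      -- (iv)
      (∀ j k, RingAdj N j k → A j k ^ 2 = 1) ∧
      (∀ k, B k ^ 2 = 1) ∧
      -- (v)
      Module.finrank ℂ ↥C = 2 ^ N ∧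
      (∀ k, ∀ ψ ∈ C, (B k).mulVec ψ ∈ C) ∧
      (∀ j k, RingAdj N j k → ∀ ψ ∈ C, (A j k).mulVec ψ ∈ C) ∧
      (Pi.single (fun _ => (0 : Fin 2)) 1 ∈ C) ∧
      (∀ ψ ∈ C,
        (localOp (none : Option (Fin N)) PauliZ *
          (List.ofFn (fun k : Fin N => localOp (some k) PauliZ)).prod).mulVec ψ
          = ψ) ∧
      (∀ ψ ∈ C,
        Complex.I ^ N •
          ((List.ofFn (fun t : Fin N => A t (t + 1))).prod).mulVec ψ = ψ) := by
  have hlast : (⟨N - 1, by omega⟩ : Fin N) + 1 = 0 := by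
    apply Fin.ext
    simp [Fin.val_add, Nat.sub_add_cancel (show 1 ≤ N by omega)]
  refine ⟨fun k => localOp (some k) PauliZ, ringOp, evenSpace (Option (Fin N)), fun _ => rfl,
    fun k hk => ?_, ?_, fun j k h => ringOp_swap hN h, rfl,
    fun k => ⟨localOp_isHermitian _ pauliZ_isHermitian, localOp_some_supported k _⟩,
    fun j k => localOp_mul_localOp_comm _ _ _,
    fun j k h => ⟨ringOp_isHermitian hN h, ringOp_supported hN h⟩,
    fun j k l h => ringOp_mul_pauliZ hN l h,
    fun j k l m h h' => ringOp_mul_ringOp hN h h',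
    fun j k h => ringOp_sq hN h, fun k => localOp_sq _ pauliZ_mul_self, ?_,
    fun k ψ hψ => mulVec_mem_evenSpace (localOp_pauliZ_commute_parityOp _) hψ,
    fun j k h ψ hψ => mulVec_mem_evenSpace (ringOp_commute_parityOp hN h) hψ,
    Submodule.subset_span ⟨_, by simp, rfl⟩, fun ψ hψ => ?_, fun ψ hψ => ?_⟩
  · rw [ringOp_succ]
    refine edgeOp_of_ne hN fun h => ?_
    have := congrArg Fin.val h
    rw [Fin.val_add_one_of_lt' (by omega)] at this
    simp at this
  · rw [← neg_edgeOp_of_eq hN hlast, ← ringOp_pred hN, hlast]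
  · rw [finrank_evenSpace_option, Fintype.card_fin]
  · rw [localOp_pauliZ_mul_prod]
    exact mem_evenSpace_iff.mp hψ
  · simp only [ringOp_succ]
    rw [prod_edgeOp hN, Matrix.smul_mulVec, mem_evenSpace_iff.mp hψ, smul_smul, ← mul_pow]
    simp
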